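/- For every natural number n, let P_n(x) = (1/(2ⁿ n!)) · (dⁿ/dxⁿ)[(x² − 1)ⁿ] (Rodrigues' formula for the n-th Legendre polynomial). Then for all x ∈ ℝ, ((1 − x²) P_n'(x))' = −n(n+1) P_n(x); that is, L₀ P_n = −n(n+1) P_n, so the numbers μ_n = −n(n+1), n ≥ 0, are eigenvalues of L₀ with polynomial eigenfunctions. -/

import Mathlib

open Real

/-- The Legendre polynomial of degree `n` via Rodrigues' formula:
`P_n(x) = (1/(2ⁿ n!)) dⁿ/dxⁿ (x² − 1)ⁿ`. -/
noncomputable def legendreP (n : ℕ) (x : ℝ) : ℝ :=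
  (1 / (2 ^ n * (n.factorial : ℝ))) * iteratedDeriv n (fun y => (y ^ 2 - 1) ^ n) x

open Polynomial in
/-- The derivative of order `k + 1` of the first-order equation satisfied by `(X ^ 2 - 1) ^ n`. -/
theorem iterate_derivative_X_sq_sub_one_pow {R : Type*} [CommRing R] (n k : ℕ) :
    (X ^ 2 - 1) * derivative^[k + 2] ((X ^ 2 - 1 : R[X]) ^ n)
      + 2 * ((k : R[X]) + 1 - (n : R[X])) * X * derivative^[k + 1] ((X ^ 2 - 1 : R[X]) ^ n)
      + ((k : R[X]) + 1) * ((k : R[X]) - 2 * (n : R[X])) * derivative^[k] ((X ^ 2 - 1 : R[X]) ^ n) = 0 := by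
  induction k with
  | zero =>
    have h : (X ^ 2 - 1) * derivative ((X ^ 2 - 1 : R[X]) ^ n)
        = 2 * (n : R[X]) * X * (X ^ 2 - 1 : R[X]) ^ n := by
      rcases n with _ | n
      · simp
      · simp [derivative_pow, map_ofNat C]
        ring
    have h' := congrArg derivative h
    simp [-map_pow] at h' ⊢
    linear_combination h'
  | succ k ih =>
    have h' := congrArg derivative ih
    simp only [Function.iterate_succ_apply'] at h' ⊢
    generalize derivative^[k] ((X ^ 2 - 1 : R[X]) ^ n) = u at h' ⊢
    simp at h' ⊢
    linear_combination h'

open Polynomial in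
theorem iteratedDeriv_polynomial_eval {𝕜 : Type*} [NontriviallyNormedField 𝕜] (p : 𝕜[X])
    (k : ℕ) : iteratedDeriv k (fun x => p.eval x) = fun x => (derivative^[k] p).eval x := by
  induction k with
  | zero => simp
  | succ k ih =>
    ext x
    rw [iteratedDeriv_succ, ih, Function.iterate_succ_apply', Polynomial.deriv]

/-- Legendre's differential equation: `((1 − x²) P_n')' = −n(n+1) P_n`, i.e. the
numbers `μ_n = −n(n+1)` are eigenvalues of `L₀` with polynomial eigenfunctions. -/
theorem legendre_eigenfunction (n : ℕ) :
    ∀ x : ℝ,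
      deriv (fun y => (1 - y ^ 2) * deriv (legendreP n) y) x
        = -((n : ℝ) * ((n : ℝ) + 1)) * legendreP n x := by
  intro x
  set q : Polynomial ℝ := Polynomial.derivative^[n] ((Polynomial.X ^ 2 - 1) ^ n) with hq
  set c : ℝ := 1 / (2 ^ n * (n.factorial : ℝ))
  have hP : legendreP n = fun y => (Polynomial.C c * q).eval y := by
    ext y
    have h := congrFun (iteratedDeriv_polynomial_eval
      ((Polynomial.X ^ 2 - 1 : Polynomial ℝ) ^ n) n) y
    simp only [Polynomial.eval_pow, Polynomial.eval_sub, Polynomial.eval_X,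
      Polynomial.eval_one] at h
    rw [legendreP, h, Polynomial.eval_C_mul]
  have hL : (fun y => (1 - y ^ 2) * deriv (legendreP n) y) =
      fun y => ((1 - Polynomial.X ^ 2) * Polynomial.derivative (Polynomial.C c * q)).eval y := by
    ext y
    rw [hP, Polynomial.deriv]
    simp
  have h := congrArg (Polynomial.eval x) (iterate_derivative_X_sq_sub_one_pow (R := ℝ) n n)
  simp only [Function.iterate_succ_apply', ← hq] at h
  rw [hL, Polynomial.deriv, hP]
  simp at h ⊢
  linear_combination -c * h
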